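/- There is no four times differentiable function u : ℝ → ℝ such that u⁗(x) = e^{u(x)} for every x ∈ ℝ and ∫_ℝ e^{u(x)} dx < +∞. (Consequently, the one-dimensional fourth-order Liouville equation admits no solution with finite volume.) -/

import Mathlib

open MeasureTheory

/-- A function whose derivative is eventually bounded below by a positive constant
tends to infinity at infinity. -/
theorem tendsto_atTop_of_eventually_le_hasDerivAt {f f' : ℝ → ℝ} {c : ℝ} (hc : 0 < c)
    (hf : ∀ x, HasDerivAt f (f' x) x) (h : ∀ᶠ x in Filter.atTop, c ≤ f' x) :
    Filter.Tendsto f Filter.atTop Filter.atTop := by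
  obtain ⟨a, ha⟩ := Filter.eventually_atTop.1 h
  have hlin : Filter.Tendsto (fun x => f a + c * (x - a)) Filter.atTop Filter.atTop :=
    Filter.tendsto_atTop_add_const_left _ _
      ((Filter.tendsto_atTop_add_const_right _ (-a) Filter.tendsto_id).const_mul_atTop hc)
  refine Filter.tendsto_atTop_mono' _ ?_ hlin
  filter_upwards [Filter.eventually_ge_atTop a] with x hx
  have key := (convex_Ici a).mul_sub_le_image_sub_of_le_deriv
    (fun y _ => (hf y).continuousAt.continuousWithinAt)
    (fun y _ => (hf y).differentiableAt.differentiableWithinAt)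
    (fun y hy => by rw [(hf y).deriv]; exact ha y (interior_subset hy))
    a Set.self_mem_Ici x hx hx
  linarith

theorem not_integrable_exp_of_tendsto_atTop {f : ℝ → ℝ}
    (hf : Filter.Tendsto f Filter.atTop Filter.atTop) :
    ¬ Integrable (fun x : ℝ => Real.exp (f x)) := by
  intro hint
  obtain ⟨b, hb⟩ := Filter.eventually_atTop.1 (hf.eventually_ge_atTop 0)
  have hlt := hint.measure_norm_ge_lt_top one_pos
  refine (hlt.trans_le le_top).not_ge ?_
  rw [← Real.volume_Ici (a := b)]
  refine measure_mono fun x hx => ?_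
  simpa using hb x hx

/-- If `e^f` is integrable and `f'''` is monotone, then `f'''` is nowhere positive. -/
theorem third_deriv_nonpos_of_integrable_exp {f f₁ f₂ f₃ : ℝ → ℝ}
    (h₀ : ∀ x, HasDerivAt f (f₁ x) x) (h₁ : ∀ x, HasDerivAt f₁ (f₂ x) x)
    (h₂ : ∀ x, HasDerivAt f₂ (f₃ x) x) (hmono : Monotone f₃)
    (hint : Integrable (fun x : ℝ => Real.exp (f x))) (a : ℝ) : f₃ a ≤ 0 := by
  by_contra! ha
  have t₂ := tendsto_atTop_of_eventually_le_hasDerivAt ha h₂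
    ((Filter.eventually_ge_atTop a).mono fun x hx => hmono hx)
  have t₁ := tendsto_atTop_of_eventually_le_hasDerivAt one_pos h₁ (t₂.eventually_ge_atTop 1)
  have t₀ := tendsto_atTop_of_eventually_le_hasDerivAt one_pos h₀ (t₁.eventually_ge_atTop 1)
  exact not_integrable_exp_of_tendsto_atTop t₀ hint

/-- The one-dimensional fourth-order Liouville equation `u⁗ = e^u` admits no four times
differentiable solution on `ℝ` with finite volume `∫ e^u < ∞`. -/
theorem stmt5 :
    ¬ ∃ u : ℝ → ℝ,
        (∀ k < 4, Differentiable ℝ (iteratedDeriv k u)) ∧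
        (∀ x : ℝ, iteratedDeriv 4 u x = Real.exp (u x)) ∧
        Integrable (fun x : ℝ => Real.exp (u x)) := by
  rintro ⟨u, hdiff, heq, hint⟩
  have hd : ∀ k < 4, ∀ x, HasDerivAt (iteratedDeriv k u) (iteratedDeriv (k + 1) u x) x := by
    intro k hk x
    rw [iteratedDeriv_succ]
    exact (hdiff k hk x).hasDerivAt
  have h₀ : ∀ x, HasDerivAt u (iteratedDeriv 1 u x) x := by
    simpa only [iteratedDeriv_zero, zero_add] using hd 0 (by norm_num)
  have hstrict : StrictMono (iteratedDeriv 3 u) := by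
    refine strictMono_of_deriv_pos fun x => ?_
    rw [(hd 3 (by norm_num) x).deriv, heq]
    exact Real.exp_pos _
  have hneg : ∀ {g g' : ℝ → ℝ}, (∀ x, HasDerivAt g (g' x) x) →
      ∀ x, HasDerivAt (fun y => g (-y)) (-g' (-x)) x := by
    intro g g' hg x
    have h := (hg (-x)).comp x (hasDerivAt_neg x)
    rwa [mul_neg_one] at h
  have hle := third_deriv_nonpos_of_integrable_exp h₀ (hd 1 (by norm_num)) (hd 2 (by norm_num))
    hstrict.monotone hint
  have hge := third_deriv_nonpos_of_integrable_exp (hneg h₀)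
    (f₂ := fun x => iteratedDeriv 2 u (-x))
    (fun x => by simpa using (hneg (hd 1 (by norm_num)) x).fun_neg)
    (hneg (hd 2 (by norm_num)))
    (fun x y hxy => neg_le_neg (hstrict.monotone (neg_le_neg hxy))) hint.comp_neg
  have h01 := hstrict (zero_lt_one' ℝ)
  have hzero := hge 0
  simp only [neg_zero] at hzero
  linarith [hle 1]
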